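/- arXiv:1305.6008 — 3 statements merged into one kernel-verified Lean document; each statement's English description precedes it below -/
import Mathlib

section
/- Closedness of the superhedgeable cone (Theorem 2.1): Let 𝒞 := {(H·S)_T : H ∈ ℋ} − ℒ⁰₊. If NA(𝒫) holds, then 𝒞 is closed under 𝒫-q.s. convergence: if W^n ∈ 𝒞 for all n ≥ 1 and W is a random variable such that W^n → W 𝒫-q.s. (pointwise outside a 𝒫-polar set), then W ∈ 𝒞. -/
open MeasureTheory Set Filter Topology
open scoped ENNReal NNReal

noncomputable section

namespace BN

/-- The universal completion of the ambient measurable structure on `α`: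
a set is measurable iff it is null-measurable for every probability measure. -/
def univComp (α : Type*) [MeasurableSpace α] : MeasurableSpace α where
  MeasurableSet' s := ∀ μ : Measure α, IsProbabilityMeasure μ → NullMeasurableSet s μ
  measurableSet_empty := fun _ _ => MeasurableSet.empty.nullMeasurableSet
  measurableSet_compl := fun _ hs μ hμ => (hs μ hμ).compl
  measurableSet_iUnion := fun _ hf μ hμ => NullMeasurableSet.iUnion fun i => hf i μ hμ

/-- `N` is `PP`-polar: it is contained in an `m`-measurable set which is null under
every `P ∈ PP`. -/
def IsPolar {α : Type*} [MeasurableSpace α] (PP : Set (Measure α)) (m : MeasurableSpace α)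
    (N : Set α) : Prop :=
  ∃ A : Set α, MeasurableSet[m] A ∧ N ⊆ A ∧ ∀ P ∈ PP, P A = 0

/-- A property holds `PP`-quasi surely if its complement is `PP`-polar. -/
def QuasiSure {α : Type*} [mα : MeasurableSpace α] (PP : Set (Measure α))
    (m : MeasurableSpace α) (p : α → Prop) : Prop :=
  @IsPolar α mα PP m {ω | ¬ p ω}

/-- Expectation of a real random variable, with the convention
`E[f] = E[f⁺] - E[f⁻]` and `∞ - ∞ = -∞` (which holds in `EReal`). -/
def expec {α : Type*} [MeasurableSpace α] (Q : Measure α) (f : α → ℝ) : EReal :=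
  ((∫⁻ x, ENNReal.ofReal (f x) ∂Q : ℝ≥0∞) : EReal)
    - ((∫⁻ x, ENNReal.ofReal (-f x) ∂Q : ℝ≥0∞) : EReal)

/-- Positive part of an extended real, valued in `ℝ≥0∞`. -/
def posE (x : EReal) : ℝ≥0∞ := if x = ⊤ then ⊤ else ENNReal.ofReal x.toReal

/-- Expectation of an extended-real random variable, with the convention
`E[f] = E[f⁺] - E[f⁻]` and `∞ - ∞ = -∞`. -/
def eexpec {α : Type*} [MeasurableSpace α] (Q : Measure α) (f : α → EReal) : EReal :=
  ((∫⁻ x, posE (f x) ∂Q : ℝ≥0∞) : EReal) - ((∫⁻ x, posE (-(f x)) ∂Q : ℝ≥0∞) : EReal)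

/-- A real-valued function is upper semianalytic if all its strict superlevel sets
are analytic. -/
def UpperSemianalytic {α : Type*} [TopologicalSpace α] (f : α → ℝ) : Prop :=
  ∀ c : ℝ, AnalyticSet {x | c < f x}

/-- An extended-real-valued function is upper semianalytic if all its strict
superlevel sets `{f > c}`, `c ∈ ℝ`, are analytic. -/
def UpperSemianalyticE {α : Type*} [TopologicalSpace α] (f : α → EReal) : Prop :=
  ∀ c : ℝ, AnalyticSet {x | (c : EReal) < f x}

/-- Convexity of a set of probability measures. -/
def ConvexPM {α : Type*} [MeasurableSpace α] (C : Set (ProbabilityMeasure α)) : Prop :=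
  ∀ μ ∈ C, ∀ ν ∈ C, ∀ a b : ℝ≥0∞, a + b = 1 →
    ∀ ξ : ProbabilityMeasure α, (ξ : Measure α) = a • (μ : Measure α) + b • (ν : Measure α) →
      ξ ∈ C

/-! ### The general (non-Polish) setting of Section 2 -/

section General

variable {Ω : Type*} [MeasurableSpace Ω]

/-- Predictability of a trading strategy `H` with respect to a filtration `F`:
the holding `H (u+1)` over the period `(u, u+1]` is `F u`-measurable. -/
def PredictableF (F : ℕ → MeasurableSpace Ω) (T d : ℕ) (H : ℕ → Ω → Fin d → ℝ) : Prop :=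
  ∀ u : ℕ, u < T → Measurable[F u] (H (u + 1))

/-- The final gain `(H · S)_T` from trading `H` in the stocks `S`. -/
def gainF {d : ℕ} (S : ℕ → Ω → Fin d → ℝ) (H : ℕ → Ω → Fin d → ℝ) (T : ℕ) (ω : Ω) : ℝ :=
  ∑ u : Fin T, ∑ i : Fin d, H (u + 1) ω i * (S (u + 1) ω i - S u ω i)

/-- The no-arbitrage condition `NA(PP)` (no options). -/
def NAF (F : ℕ → MeasurableSpace Ω) (T d : ℕ) (S : ℕ → Ω → Fin d → ℝ)
    (PP : Set (Measure Ω)) : Prop :=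
  ∀ H : ℕ → Ω → Fin d → ℝ, PredictableF F T d H →
    QuasiSure PP ‹MeasurableSpace Ω› (fun ω => 0 ≤ gainF S H T ω) →
      QuasiSure PP ‹MeasurableSpace Ω› (fun ω => gainF S H T ω = 0)

/-- The cone `𝒞` of claims superreplicable from zero initial capital. -/
def Cset (F : ℕ → MeasurableSpace Ω) (T d : ℕ) (S : ℕ → Ω → Fin d → ℝ) : Set (Ω → ℝ) :=
  {W | ∃ H : ℕ → Ω → Fin d → ℝ, PredictableF F T d H ∧
    ∃ K : Ω → ℝ, Measurable K ∧ (∀ ω, 0 ≤ K ω) ∧ ∀ ω, W ω = gainF S H T ω - K ω}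

/-- The superhedging price (no options), with values in `EReal` (`inf ∅ = +∞`). -/
def superPriceF (F : ℕ → MeasurableSpace Ω) (T d : ℕ) (S : ℕ → Ω → Fin d → ℝ)
    (PP : Set (Measure Ω)) (f : Ω → ℝ) : EReal :=
  sInf ((fun x : ℝ => (x : EReal)) ''
    {x : ℝ | ∃ H : ℕ → Ω → Fin d → ℝ, PredictableF F T d H ∧
      QuasiSure PP ‹MeasurableSpace Ω› (fun ω => f ω ≤ x + gainF S H T ω)})

end General

/-! ### The one-period setting of Section 3 -/

section OnePeriod

variable {Ω : Type*} [MeasurableSpace Ω] {d : ℕ}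

/-- One-period no-arbitrage condition `NA(PP)` for the increment `ΔS`. -/
def NA1 (PP : Set (Measure Ω)) (ΔS : Ω → Fin d → ℝ) : Prop :=
  ∀ y : Fin d → ℝ,
    QuasiSure PP ‹MeasurableSpace Ω› (fun ω => 0 ≤ ∑ i, y i * ΔS ω i) →
      QuasiSure PP ‹MeasurableSpace Ω› (fun ω => ∑ i, y i * ΔS ω i = 0)

/-- The martingale measures dominated by `PP` in the one-period market:
`𝒬 = {Q : Q ⋘ 𝒫, E_Q[ΔS] = 0}`. -/
def Q1set (PP : Set (Measure Ω)) (ΔS : Ω → Fin d → ℝ) : Set (Measure Ω) :=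
  {Q | IsProbabilityMeasure Q ∧ (∃ P ∈ PP, Q ≪ P) ∧
    ∀ i, expec Q (fun ω => ΔS ω i) = 0}

/-- One-period superhedging price, with values in `EReal` (`inf ∅ = +∞`). -/
def superPrice1 (PP : Set (Measure Ω)) (ΔS : Ω → Fin d → ℝ) (f : Ω → ℝ) : EReal :=
  sInf ((fun x : ℝ => (x : EReal)) ''
    {x : ℝ | ∃ H : Fin d → ℝ,
      QuasiSure PP ‹MeasurableSpace Ω› (fun ω => f ω ≤ x + ∑ i, H i * ΔS ω i)})

end OnePeriod

/-! ### The Polish multi-period setting -/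

section Polish

variable (Ω₁ : Type) [MeasurableSpace Ω₁]

/-- Restriction of a path up to time `t`. -/
def restr {T : ℕ} (t : ℕ) (h : t ≤ T) (ω : Fin T → Ω₁) : Fin t → Ω₁ :=
  fun i => ω (Fin.castLE h i)

/-- Universally measurable predictability: `H u` (the holding over `(u, u+1]`)
is a universally measurable function of the first `u` coordinates. -/
def Pred (d : ℕ) (H : (u : ℕ) → (Fin u → Ω₁) → Fin d → ℝ) : Prop :=
  ∀ u : ℕ, @Measurable _ _ (univComp (Fin u → Ω₁)) _ (H u)

/-- The gain `(H · S)_t = ∑_{u=1}^t H_u (S_u - S_{u-1})` up to time `t ≤ T`. -/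
def gain {T d : ℕ} (S : (t : ℕ) → (Fin t → Ω₁) → Fin d → ℝ)
    (H : (u : ℕ) → (Fin u → Ω₁) → Fin d → ℝ) (t : ℕ) (h : t ≤ T) (ω : Fin T → Ω₁) : ℝ :=
  ∑ u : Fin t, ∑ i : Fin d,
    H u (restr Ω₁ u (u.2.le.trans h) ω) i *
      (S (u + 1) (restr Ω₁ (u + 1) (Nat.succ_le_of_lt (u.2.trans_le h)) ω) i
        - S u (restr Ω₁ u (u.2.le.trans h) ω) i)

variable [TopologicalSpace Ω₁] [OpensMeasurableSpace Ω₁]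

/-- The set `PP = {P₀ ⊗ ⋯ ⊗ P_{t-1}}` of measures built from universally
measurable selectors of the one-step collections `𝒫_s(·)`. -/
def MeasFam (Pt : (t : ℕ) → (Fin t → Ω₁) → Set (ProbabilityMeasure Ω₁)) :
    (t : ℕ) → Set (Measure (Fin t → Ω₁))
  | 0 => {μ | μ = Measure.dirac Fin.elim0}
  | (t + 1) => {μ | ∃ ν ∈ MeasFam Pt t, ∃ κ : (Fin t → Ω₁) → ProbabilityMeasure Ω₁,
      @Measurable _ _ (univComp (Fin t → Ω₁)) (borel (ProbabilityMeasure Ω₁)) κ ∧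
      (∀ ω, κ ω ∈ Pt t ω) ∧
      μ = ν.bind (fun ω => Measure.map (Fin.snoc ω) (κ ω : Measure Ω₁))}

/-- The σ-field `ℱ_t` on `Ω = Ω₁^T`: the comap under the restriction map of the
universal completion of the Borel σ-field of `Ω₁^t`. -/
def filtr (T : ℕ) (t : ℕ) (h : t ≤ T) : MeasurableSpace (Fin T → Ω₁) :=
  MeasurableSpace.comap (restr Ω₁ t h) (univComp (Fin t → Ω₁))

/-- `S` is a `Q`-martingale with respect to the filtration `(ℱ_t)`. -/
def IsMartMeas {T d : ℕ} (S : (t : ℕ) → (Fin t → Ω₁) → Fin d → ℝ)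
    (Q : Measure (Fin T → Ω₁)) : Prop :=
  (∀ (t : ℕ) (h : t ≤ T) (i : Fin d), Integrable (fun ω => S t (restr Ω₁ t h ω) i) Q) ∧
  (∀ (t : ℕ) (h : t + 1 ≤ T) (i : Fin d) (A : Set (Fin T → Ω₁)),
    MeasurableSet[filtr Ω₁ T t ((Nat.le_succ t).trans h)] A →
      ∫ ω in A, S (t + 1) (restr Ω₁ (t + 1) h ω) i ∂Q
        = ∫ ω in A, S t (restr Ω₁ t ((Nat.le_succ t).trans h) ω) i ∂Q)

/-- The martingale measures `Q ⋘ PP` consistent with the option prices: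
`𝒬 = {Q ⋘ PP : S is a Q-martingale, E_Q[gⁱ] = 0}`. -/
def QSet {T d e : ℕ} (PP : Set (Measure (Fin T → Ω₁)))
    (S : (t : ℕ) → (Fin t → Ω₁) → Fin d → ℝ) (g : Fin e → (Fin T → Ω₁) → ℝ) :
    Set (Measure (Fin T → Ω₁)) :=
  {Q | IsProbabilityMeasure Q ∧ (∃ P ∈ PP, Q ≪ P) ∧ IsMartMeas Ω₁ S Q ∧
    ∀ i : Fin e, expec Q (g i) = 0}

/-- The no-arbitrage condition `NA(PP)` with semistatic trading in the stocks `S`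
and the options `g`. -/
def NA {T d e : ℕ} (PP : Set (Measure (Fin T → Ω₁)))
    (S : (t : ℕ) → (Fin t → Ω₁) → Fin d → ℝ) (g : Fin e → (Fin T → Ω₁) → ℝ) : Prop :=
  ∀ H : (u : ℕ) → (Fin u → Ω₁) → Fin d → ℝ, Pred Ω₁ d H → ∀ h : Fin e → ℝ,
    QuasiSure PP (univComp (Fin T → Ω₁))
      (fun ω => 0 ≤ gain Ω₁ S H T le_rfl ω + ∑ i, h i * g i ω) →
    QuasiSure PP (univComp (Fin T → Ω₁))
      (fun ω => gain Ω₁ S H T le_rfl ω + ∑ i, h i * g i ω = 0)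

/-- The minimal semistatic superhedging price, valued in `EReal` (`inf ∅ = +∞`). -/
def superPrice {T d e : ℕ} (PP : Set (Measure (Fin T → Ω₁)))
    (S : (t : ℕ) → (Fin t → Ω₁) → Fin d → ℝ) (g : Fin e → (Fin T → Ω₁) → ℝ)
    (f : (Fin T → Ω₁) → ℝ) : EReal :=
  sInf ((fun x : ℝ => (x : EReal)) ''
    {x : ℝ | ∃ H : (u : ℕ) → (Fin u → Ω₁) → Fin d → ℝ, ∃ h : Fin e → ℝ, Pred Ω₁ d H ∧
      QuasiSure PP (univComp (Fin T → Ω₁))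
        (fun ω => f ω ≤ x + gain Ω₁ S H T le_rfl ω + ∑ i, h i * g i ω)})

/-- `f` is replicable by semistatic trading. -/
def Replicable {T d e : ℕ} (PP : Set (Measure (Fin T → Ω₁)))
    (S : (t : ℕ) → (Fin t → Ω₁) → Fin d → ℝ) (g : Fin e → (Fin T → Ω₁) → ℝ)
    (f : (Fin T → Ω₁) → ℝ) : Prop :=
  ∃ x : ℝ, ∃ H : (u : ℕ) → (Fin u → Ω₁) → Fin d → ℝ, ∃ h : Fin e → ℝ, Pred Ω₁ d H ∧
    QuasiSure PP (univComp (Fin T → Ω₁))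
      (fun ω => x + gain Ω₁ S H T le_rfl ω + ∑ i, h i * g i ω = f ω)

/-- The one-period increment `ΔS_{t+1}(ω, ·)` of the stock, given history `ω ∈ Ω_t`. -/
def incr {d : ℕ} (S : (t : ℕ) → (Fin t → Ω₁) → Fin d → ℝ) (t : ℕ) (ω : Fin t → Ω₁)
    (x : Ω₁) : Fin d → ℝ :=
  fun i => S (t + 1) (Fin.snoc ω x) i - S t ω i

/-- The one-step martingale measures `𝒬_t(ω)` dominated by `𝒫_t(ω)`. -/
def Q1fam {d : ℕ} (Pt : (t : ℕ) → (Fin t → Ω₁) → Set (ProbabilityMeasure Ω₁))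
    (S : (t : ℕ) → (Fin t → Ω₁) → Fin d → ℝ) (t : ℕ) (ω : Fin t → Ω₁) :
    Set (ProbabilityMeasure Ω₁) :=
  {Q | (∃ P' ∈ Pt t ω, (Q : Measure Ω₁) ≪ (P' : Measure Ω₁)) ∧
    ∀ i, expec (Q : Measure Ω₁) (fun x => incr Ω₁ S t ω x i) = 0}

/-- `V` is a `Q`-supermartingale with respect to the filtration `(ℱ_t)`:
each `V_t` is `Q`-integrable and `E_Q[V_{t+1} | ℱ_t] ≤ V_t`. -/
def IsSupermart {T : ℕ} (V : ℕ → (Fin T → Ω₁) → ℝ) (Q : Measure (Fin T → Ω₁)) : Prop :=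
  (∀ t : ℕ, t ≤ T → Integrable (V t) Q) ∧
  ∀ (t : ℕ) (h : t + 1 ≤ T) (A : Set (Fin T → Ω₁)),
    MeasurableSet[filtr Ω₁ T t ((Nat.le_succ t).trans h)] A →
      ∫ ω in A, V (t + 1) ω ∂Q ≤ ∫ ω in A, V t ω ∂Q

end Polish

/-! ### Quasi-sure supports -/

/-- The quasi-sure support of a family of measures on `ℝ^d`. -/
def qsSupp {d : ℕ} (Rs : Set (Measure (Fin d → ℝ))) : Set (Fin d → ℝ) :=
  ⋂₀ {A : Set (Fin d → ℝ) | IsClosed A ∧ ∀ R ∈ Rs, R A = 1}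

end BN

/-! ### Measurable random subsequences -/

/-- Evaluating a sequence of measurable functions at a measurable random index. -/
lemma measurable_eval_randomIndex {Ω β : Type*} [MeasurableSpace Ω] [MeasurableSpace β]
    {f : ℕ → Ω → β} (hf : ∀ n, Measurable (f n)) {τ : Ω → ℕ} (hτ : Measurable τ) :
    Measurable fun ω => f (τ ω) ω :=
  (measurable_from_prod_countable_left (f := fun p : Ω × ℕ => f p.2 p.1) hf).comp
    (measurable_id.prodMk hτ)

/-- If `|u n|` does not tend to infinity, then its lower limit `L` is finite, and `L` or `-L`
is a cluster point of `u`. -/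
lemma frequently_near_liminf_abs_or_neg {u : ℕ → ℝ}
    (hu : ¬ Tendsto (fun n => |u n|) atTop atTop) :
    (∀ k : ℕ, ∃ᶠ n in atTop, |u n - liminf (fun n => |u n|) atTop| < 1 / ((k : ℝ) + 1)) ∨
    (∀ k : ℕ, ∃ᶠ n in atTop, |u n + liminf (fun n => |u n|) atTop| < 1 / ((k : ℝ) + 1)) := by
  set L := liminf (fun n => |u n|) atTop
  have hbdd : IsBoundedUnder (· ≥ ·) atTop (fun n => |u n|) :=
    isBoundedUnder_of ⟨0, fun n => abs_nonneg (u n)⟩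
  have hcob : IsCoboundedUnder (· ≥ ·) atTop (fun n => |u n|) := by
    rw [tendsto_atTop] at hu
    push Not at hu
    obtain ⟨M, hM⟩ := hu
    exact IsCoboundedUnder.of_frequently_le (a := M) (hM.mono fun n hn => hn.le)
  have hnear : ∀ ε > 0, ∃ᶠ n in atTop, |u n - L| < ε ∨ |u n + L| < ε := by
    intro ε hε
    have hlt : ∃ᶠ n in atTop, |u n| < L + ε :=
      frequently_lt_of_liminf_lt hcob (by linarith)
    have hgt : ∀ᶠ n in atTop, L - ε < |u n| :=
      eventually_lt_of_lt_liminf (by linarith) hbdd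
    refine (hlt.and_eventually hgt).mono fun n hn => ?_
    rcases abs_cases (u n) with h | h
    · left; rw [abs_lt]; constructor <;> linarith [hn.1, hn.2]
    · right; rw [abs_lt]; constructor <;> linarith [hn.1, hn.2]
  by_contra! hcon
  obtain ⟨⟨k, hk⟩, ⟨l, hl⟩⟩ := hcon
  have hpos : (0 : ℝ) < min (1 / ((k : ℝ) + 1)) (1 / ((l : ℝ) + 1)) := by positivity
  obtain ⟨n, hn, hnk, hnl⟩ := ((hnear _ hpos).and_eventually (hk.and hl)).exists
  rcases hn with hn | hn
  · exact hnk.not_gt (hn.trans_le (min_le_left _ _))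
  · exact hnl.not_gt (hn.trans_le (min_le_right _ _))

lemma measurableSet_frequently_atTop {Ω : Type*} [MeasurableSpace Ω] {p : ℕ → Ω → Prop}
    (hp : ∀ n, MeasurableSet {ω | p n ω}) : MeasurableSet {ω | ∃ᶠ n in atTop, p n ω} := by
  simp only [frequently_atTop]
  measurability

/-- A sequence of measurable functions that pointwise does not diverge to infinity in absolute
value has a convergent subsequence along measurable random indices. -/
lemma exists_measurable_convergent_subseq {Ω : Type*} [MeasurableSpace Ω] {f : ℕ → Ω → ℝ}
    (hf : ∀ n, Measurable (f n)) (hb : ∀ ω, ¬ Tendsto (fun n => |f n ω|) atTop atTop) :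
    ∃ c : Ω → ℝ, Measurable c ∧ ∃ τ : ℕ → Ω → ℕ, (∀ k, Measurable (τ k)) ∧
      (∀ ω, Tendsto (fun k => τ k ω) atTop atTop) ∧
      ∀ ω, Tendsto (fun k => f (τ k ω) ω) atTop (𝓝 (c ω)) := by
  classical
  set L : Ω → ℝ := fun ω => liminf (fun n => |f n ω|) atTop
  have hLm : Measurable L := Measurable.liminf fun n => (hf n).abs
  set B : Set Ω := {ω | ∀ k : ℕ, ∃ᶠ n in atTop, |f n ω - L ω| < 1 / ((k : ℝ) + 1)} with hB
  have hBm : MeasurableSet B := by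
    have : B = ⋂ k : ℕ, {ω | ∃ᶠ n in atTop, |f n ω - L ω| < 1 / ((k : ℝ) + 1)} := by
      ext ω; simp [hB]
    rw [this]
    exact MeasurableSet.iInter fun k => measurableSet_frequently_atTop fun n =>
      measurableSet_lt ((hf n).sub hLm).abs measurable_const
  set c : Ω → ℝ := B.piecewise L (fun ω => - L ω) with hc
  have hcm : Measurable c := Measurable.piecewise hBm hLm hLm.neg
  have hfreq : ∀ ω, ∀ k : ℕ, ∃ᶠ n in atTop, |f n ω - c ω| < 1 / ((k : ℝ) + 1) := by
    intro ω
    by_cases hω : ω ∈ B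
    · simp only [hc, Set.piecewise_eq_of_mem _ _ _ hω]
      exact hω
    · have := (frequently_near_liminf_abs_or_neg (hb ω)).resolve_left hω
      simpa [hc, hω] using this
  have hex : ∀ (k : ℕ) (ω : Ω), ∃ n, k ≤ n ∧ |f n ω - c ω| < 1 / ((k : ℝ) + 1) :=
    fun k ω => frequently_atTop.1 (hfreq ω k) k
  refine ⟨c, hcm, fun k ω => Nat.find (hex k ω), fun k => ?_, fun ω => ?_, fun ω => ?_⟩
  · refine measurable_find (hex k) fun n => ?_
    exact (MeasurableSet.const _).inter
      (measurableSet_lt ((hf n).sub hcm).abs measurable_const)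
  · exact tendsto_atTop_mono (fun k => (Nat.find_spec (hex k ω)).1) tendsto_id
  · rw [tendsto_iff_dist_tendsto_zero]
    refine squeeze_zero (fun _ => dist_nonneg) (fun k => ?_)
      tendsto_one_div_add_atTop_nhds_zero_nat
    rw [Real.dist_eq]
    exact (Nat.find_spec (hex k ω)).2.le

/-! ### Superhedging with scalar trades, modulo a σ-filter -/

/-- One-step reduction: if the first holdings do not diverge to infinity and the superhedging
property passes to limits for the remaining trades, then it passes to the limit for all trades,
with first holding a cluster point of the given ones. -/
lemma exists_superhedge_of_not_tendsto {Ω : Type*} {l : Filter Ω} [CountableInterFilter l] {N : ℕ}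
    {G : Fin (N + 1) → MeasurableSpace Ω} (hG : Monotone G) {X : Fin (N + 1) → Ω → ℝ}
    (hclosed : ∀ (h : ℕ → Fin N → Ω → ℝ) (W : ℕ → Ω → ℝ) (V : Ω → ℝ),
      (∀ n j, Measurable[G j.succ] (h n j)) →
      (∀ n, ∀ᶠ ω in l, W n ω ≤ ∑ j, h n j ω * X j.succ ω) →
      (∀ᶠ ω in l, Tendsto (fun n => W n ω) atTop (𝓝 (V ω))) →
      ∃ g : Fin N → Ω → ℝ, (∀ j, Measurable[G j.succ] (g j)) ∧
        ∀ᶠ ω in l, V ω ≤ ∑ j, g j ω * X j.succ ω)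
    {h : ℕ → Fin (N + 1) → Ω → ℝ} {W : ℕ → Ω → ℝ} {V : Ω → ℝ}
    (hh : ∀ n j, Measurable[G j] (h n j))
    (hW : ∀ n, ∀ᶠ ω in l, W n ω ≤ ∑ j, h n j ω * X j ω)
    (hV : ∀ᶠ ω in l, Tendsto (fun n => W n ω) atTop (𝓝 (V ω)))
    (hb : ∀ ω, ¬ Tendsto (fun n => |h n 0 ω|) atTop atTop) :
    ∃ g : Fin (N + 1) → Ω → ℝ, (∀ j, Measurable[G j] (g j)) ∧
      (∀ᶠ ω in l, V ω ≤ ∑ j, g j ω * X j ω) ∧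
      ∀ ω, ∃ s : ℕ → ℕ, Tendsto s atTop atTop ∧
        Tendsto (fun k => h (s k) 0 ω) atTop (𝓝 (g 0 ω)) := by
  obtain ⟨c, hc, τ, hτ, hτtop, hτc⟩ :=
    @exists_measurable_convergent_subseq Ω (G 0) (fun n => h n 0) (fun n => hh n 0) hb
  obtain ⟨g, hg, hgV⟩ := hclosed (fun k j ω => h (τ k ω) j.succ ω)
    (fun k ω => W (τ k ω) ω - h (τ k ω) 0 ω * X 0 ω) (fun ω => V ω - c ω * X 0 ω)
    (fun k j => @measurable_eval_randomIndex _ _ (G j.succ) _ (fun n => h n j.succ)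
      (fun n => hh n j.succ) _ ((hτ k).mono (hG (Fin.zero_le _)) le_rfl))
    (fun k => by
      filter_upwards [eventually_countable_forall.2 hW] with ω hω
      have := hω (τ k ω)
      rw [Fin.sum_univ_succ] at this
      linarith)
    (by
      filter_upwards [hV] with ω hω
      exact (hω.comp (hτtop ω)).sub ((hτc ω).mul_const _))
  refine ⟨Fin.cons c g, fun j => ?_, ?_, fun ω => ⟨fun k => τ k ω, hτtop ω, hτc ω⟩⟩
  · cases j using Fin.cases with
    | zero => exact hc
    | succ j => exact hg j
  · filter_upwards [hgV] with ω hω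
    rw [Fin.sum_univ_succ]
    simp only [Fin.cons_zero, Fin.cons_succ]
    linarith

/-- Under no-arbitrage, limits of superhedgeable claims are superhedgeable, for finitely many
scalar trades `X j` with `G j`-measurable holdings. Inequalities are understood modulo an
arbitrary filter with the countable intersection property. -/
theorem exists_superhedge_limit {Ω : Type*} {l : Filter Ω} [CountableInterFilter l] {N : ℕ}
    {G : Fin N → MeasurableSpace Ω} (hG : Monotone G) {X : Fin N → Ω → ℝ}
    (hNA : ∀ h : Fin N → Ω → ℝ, (∀ j, Measurable[G j] (h j)) →
      (∀ᶠ ω in l, 0 ≤ ∑ j, h j ω * X j ω) → ∀ᶠ ω in l, ∑ j, h j ω * X j ω = 0)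
    {h : ℕ → Fin N → Ω → ℝ} {W : ℕ → Ω → ℝ} {V : Ω → ℝ}
    (hh : ∀ n j, Measurable[G j] (h n j))
    (hW : ∀ n, ∀ᶠ ω in l, W n ω ≤ ∑ j, h n j ω * X j ω)
    (hV : ∀ᶠ ω in l, Tendsto (fun n => W n ω) atTop (𝓝 (V ω))) :
    ∃ g : Fin N → Ω → ℝ, (∀ j, Measurable[G j] (g j)) ∧
      ∀ᶠ ω in l, V ω ≤ ∑ j, g j ω * X j ω := by
  classical
  induction N generalizing W V with
  | zero =>
    refine ⟨fun j => j.elim0, fun j => j.elim0, ?_⟩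
    filter_upwards [eventually_countable_forall.2 hW, hV] with ω hω hlim
    exact le_of_tendsto' hlim fun n => by simpa using hω n
  | succ N ih =>
    have hclosed : ∀ (h : ℕ → Fin N → Ω → ℝ) (W : ℕ → Ω → ℝ) (V : Ω → ℝ),
        (∀ n j, Measurable[G j.succ] (h n j)) →
        (∀ n, ∀ᶠ ω in l, W n ω ≤ ∑ j, h n j ω * X j.succ ω) →
        (∀ᶠ ω in l, Tendsto (fun n => W n ω) atTop (𝓝 (V ω))) →
        ∃ g : Fin N → Ω → ℝ, (∀ j, Measurable[G j.succ] (g j)) ∧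
          ∀ᶠ ω in l, V ω ≤ ∑ j, g j ω * X j.succ ω := by
      intro h W V hh hW hV
      refine ih (G := fun j => G j.succ) (X := fun j => X j.succ)
        (fun i j hij => hG (Fin.succ_le_succ_iff.2 hij)) (fun f hf hf0 => ?_) hh hW hV
      have key := hNA (Fin.cons (fun _ => 0) f) (fun j => by
        cases j using Fin.cases with
        | zero => exact measurable_const
        | succ j => exact hf j)
      simpa [Fin.sum_univ_succ] using key (by simpa [Fin.sum_univ_succ] using hf0)
    -- the event on which the first holdings diverge
    set B : Set Ω := {ω | Tendsto (fun n => |h n 0 ω|) atTop atTop}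
    have hBm : ∀ j, MeasurableSet[G j] B := fun j => by
      refine hG (Fin.zero_le j) _ ?_
      let := G 0
      exact measurableSet_tendsto atTop fun n => (hh n 0).abs
    have hh0 : ∀ n j, Measurable[G j] (h n 0) := fun n j =>
      (hh n 0).mono (hG (Fin.zero_le j)) le_rfl
    -- the normalized strategies yield a strategy with nonnegative gain on `B`
    obtain ⟨g, hg, hg0, hgs⟩ := exists_superhedge_of_not_tendsto hG hclosed
      (h := fun n j => B.indicator fun ω => h n j ω / |h n 0 ω|)
      (W := fun n => B.indicator fun ω => W n ω / |h n 0 ω|) (V := fun _ => 0)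
      (fun n j => by
        let := G j
        exact Measurable.indicator ((hh n j).div (hh0 n j).abs) (hBm j))
      (fun n => by
        filter_upwards [hW n] with ω hω
        by_cases hωB : ω ∈ B
        · simp only [Set.indicator_of_mem hωB, div_mul_eq_mul_div, ← Finset.sum_div]
          exact div_le_div_of_nonneg_right hω (abs_nonneg _)
        · simp [Set.indicator_of_notMem hωB])
      (by
        filter_upwards [hV] with ω hω
        by_cases hωB : ω ∈ B
        · simp only [Set.indicator_of_mem hωB]
          exact hω.div_atTop hωB
        · simp [Set.indicator_of_notMem hωB])
      (fun ω hω => by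
        have hle : ∀ n, |B.indicator (fun ω => h n 0 ω / |h n 0 ω|) ω| ≤ 1 := by
          intro n
          by_cases hωB : ω ∈ B
          · simp only [Set.indicator_of_mem hωB, abs_div, abs_abs]
            exact div_self_le_one _
          · simp [Set.indicator_of_notMem hωB]
        obtain ⟨n, hn⟩ := (hω.eventually_gt_atTop 1).exists
        exact absurd (hle n) (not_le.2 hn))
    have hg_ne : ∀ ω ∈ B, g 0 ω ≠ 0 := by
      intro ω hωB h0
      obtain ⟨s, hs, hlim⟩ := hgs ω
      simp only [Set.indicator_of_mem hωB, h0] at hlim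
      have hone : (fun k => |h (s k) 0 ω / abs (h (s k) 0 ω)|) =ᶠ[atTop] fun _ => (1 : ℝ) := by
        have hωB' : Tendsto (fun n => |h n 0 ω|) atTop atTop := hωB
        filter_upwards [(hωB'.comp hs).eventually_gt_atTop 0] with k hk
        rw [abs_div, abs_abs]
        exact div_self hk.ne'
      have := tendsto_nhds_unique (hlim.abs.congr' hone) tendsto_const_nhds
      simp at this
    -- by no-arbitrage, the gain of this strategy vanishes on `B`
    have hzero := hNA (fun j => B.indicator (g j))
      (fun j => by
        let := G j
        exact (hg j).indicator (hBm j))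
      (by
        filter_upwards [hg0] with ω hω
        by_cases hωB : ω ∈ B
        · simpa only [Set.indicator_of_mem hωB] using hω
        · simp [Set.indicator_of_notMem hωB])
    have hg0m : ∀ j, Measurable[G j] (g 0) := fun j =>
      (hg 0).mono (hG (Fin.zero_le j)) le_rfl
    -- subtract a multiple of it in order to cancel the first holdings on `B`
    obtain ⟨f, hf, hfV, -⟩ := exists_superhedge_of_not_tendsto hG hclosed
      (h := fun n j ω => h n j ω - h n 0 ω / g 0 ω * B.indicator (g j) ω) (W := W) (V := V)
      (fun n j => by
        let := G j
        exact (hh n j).sub (((hh0 n j).div (hg0m j)).mul ((hg j).indicator (hBm j))))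
      (fun n => by
        filter_upwards [hW n, hzero] with ω hω hω0
        simp only [sub_mul, mul_assoc, Finset.sum_sub_distrib, ← Finset.mul_sum, hω0]
        simpa using hω)
      hV
      (fun ω => by
        by_cases hωB : ω ∈ B
        · simp only [Set.indicator_of_mem hωB, div_mul_cancel₀ _ (hg_ne ω hωB), sub_self, abs_zero]
          exact not_tendsto_const_atTop _ _
        · simp only [Set.indicator_of_notMem hωB, mul_zero, sub_zero]
          exact hωB)
    exact ⟨f, hf, hfV⟩

namespace BN

/-- The filter of sets whose complement is polar. -/
def qsFilter {Ω : Type*} [m : MeasurableSpace Ω] (PP : Set (Measure Ω)) : Filter Ω :=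
  Filter.ofCountableUnion {N | IsPolar PP m N}
    (fun S hS hp => by
      choose! A hAm hNA hA0 using hp
      exact ⟨⋃ s ∈ S, A s, MeasurableSet.biUnion hS hAm,
        Set.sUnion_subset fun s hs => (hNA s hs).trans (Set.subset_biUnion_of_mem hs),
        fun P hP => (measure_biUnion_null_iff hS).2 fun s hs => hA0 s hs P hP⟩)
    (fun _ ⟨A, hAm, hNA, hA0⟩ _ hs => ⟨A, hAm, hs.trans hNA, hA0⟩)

instance {Ω : Type*} [MeasurableSpace Ω] (PP : Set (Measure Ω)) :
    CountableInterFilter (qsFilter PP) :=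
  countableInter_ofCountableUnion ..

lemma eventually_qsFilter {Ω : Type*} [m : MeasurableSpace Ω] {PP : Set (Measure Ω)}
    {p : Ω → Prop} : (∀ᶠ ω in qsFilter PP, p ω) ↔ QuasiSure PP m p :=
  Iff.rfl

/-- The strategy whose holdings are given by a family indexed by flattened (period, asset)
pairs. -/
def unflatten {Ω : Type*} {T d : ℕ} (h : Fin (T * d) → Ω → ℝ) : ℕ → Ω → Fin d → ℝ :=
  fun t ω i => if ht : t - 1 < T then h (finProdFinEquiv (⟨t - 1, ht⟩, i)) ω else 0

/-- The scalar price increments indexed by flattened (period, asset) pairs. -/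
def flatIncr {Ω : Type*} {T d : ℕ} (S : ℕ → Ω → Fin d → ℝ) (j : Fin (T * d)) (ω : Ω) : ℝ :=
  S (j.divNat + 1) ω j.modNat - S j.divNat ω j.modNat

lemma gainF_eq_sum_flat {Ω : Type*} {T d : ℕ} (S H : ℕ → Ω → Fin d → ℝ) (ω : Ω) :
    gainF S H T ω = ∑ j : Fin (T * d), H (j.divNat + 1) ω j.modNat * flatIncr S j ω := by
  rw [gainF, ← Fintype.sum_prod_type' (f := fun (u : Fin T) (i : Fin d) =>
    H (u + 1) ω i * (S (u + 1) ω i - S u ω i)), ← finProdFinEquiv.symm.sum_comp]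
  rfl

lemma gainF_unflatten {Ω : Type*} {T d : ℕ} (S : ℕ → Ω → Fin d → ℝ)
    (h : Fin (T * d) → Ω → ℝ) (ω : Ω) :
    gainF S (unflatten h) T ω = ∑ j, h j ω * flatIncr S j ω := by
  rw [gainF_eq_sum_flat]
  refine Finset.sum_congr rfl fun j _ => ?_
  have hj : finProdFinEquiv (j.divNat, j.modNat) = j := finProdFinEquiv.apply_symm_apply j
  have hlt : (j.divNat : ℕ) + 1 - 1 < T := j.divNat.2
  rw [unflatten, dif_pos hlt]
  exact congrArg (fun k => h k ω * flatIncr S j ω) hj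

lemma predictableF_unflatten {Ω : Type*} {F : ℕ → MeasurableSpace Ω} {T d : ℕ}
    {h : Fin (T * d) → Ω → ℝ} (hh : ∀ j, Measurable[F j.divNat] (h j)) :
    PredictableF F T d (unflatten h) := by
  intro u hu
  refine @measurable_pi_lambda _ _ _ (F u) _ _ fun i => ?_
  have key := hh (finProdFinEquiv (⟨u, hu⟩, i))
  have hdiv : (finProdFinEquiv ((⟨u, hu⟩ : Fin T), i)).divNat = ⟨u, hu⟩ :=
    congrArg Prod.fst (finProdFinEquiv.symm_apply_apply ((⟨u, hu⟩ : Fin T), i))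
  rw [hdiv] at key
  simpa [unflatten, hu] using key

lemma measurable_gainF {Ω : Type*} [m : MeasurableSpace Ω] {F : ℕ → MeasurableSpace Ω}
    {T d : ℕ} (hF : ∀ t, F t ≤ m) {S H : ℕ → Ω → Fin d → ℝ}
    (hS : ∀ t, t ≤ T → Measurable (S t)) (hH : PredictableF F T d H) :
    Measurable (gainF S H T) := by
  refine Finset.measurable_fun_sum _ fun u _ => Finset.measurable_fun_sum _ fun i _ => ?_
  have hHu : Measurable (H (u + 1)) := (hH u u.2).mono (hF u) le_rfl
  exact ((measurable_pi_apply i).comp hHu).mul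
    (((measurable_pi_apply i).comp (hS _ u.2)).sub ((measurable_pi_apply i).comp (hS _ u.2.le)))

end BN

open BN in
/-- **Closedness of the superhedgeable cone** (Theorem 2.1). Under `NA(𝒫)`, the cone
`𝒞 = {(H·S)_T : H ∈ ℋ} - ℒ⁰₊` is closed under `𝒫`-quasi-sure convergence: any
random variable which is a `𝒫`-q.s. limit of elements of `𝒞` coincides `𝒫`-q.s.
with an element of `𝒞`. -/
theorem superhedgeable_cone_closed
    (Ω : Type) [m : MeasurableSpace Ω] (T d : ℕ)
    (F : ℕ → MeasurableSpace Ω) (hFmono : ∀ t, F t ≤ F (t + 1)) (hFle : ∀ t, F t ≤ m)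
    (PP : Set (Measure Ω)) (hne : PP.Nonempty) (hprob : ∀ P ∈ PP, IsProbabilityMeasure P)
    (S : ℕ → Ω → Fin d → ℝ) (hS : ∀ t, t ≤ T → Measurable (S t))
    (hNA : NAF F T d S PP)
    (W : ℕ → Ω → ℝ) (hW : ∀ n : ℕ, W n ∈ Cset F T d S)
    (Wl : Ω → ℝ) (hWl : Measurable Wl)
    (hconv : QuasiSure PP m (fun ω => Filter.Tendsto (fun n => W n ω) Filter.atTop (nhds (Wl ω)))) :
    ∃ W' ∈ Cset F T d S, QuasiSure PP m (fun ω => Wl ω = W' ω) := by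
  choose H hH K _ hK0 hWK using hW
  have hG : Monotone fun j : Fin (T * d) => F j.divNat := fun i j hij =>
    monotone_nat_of_le_succ hFmono (Nat.div_le_div_right hij)
  obtain ⟨g, hg, hgW⟩ := exists_superhedge_limit (l := qsFilter PP) hG (X := flatIncr S)
    (fun h hh hpos => by
      simp only [← gainF_unflatten] at hpos ⊢
      exact hNA _ (predictableF_unflatten hh) hpos)
    (h := fun n j ω => H n (j.divNat + 1) ω j.modNat) (W := W) (V := Wl)
    (fun n j => @Measurable.eval _ _ _ (F j.divNat) _ j.modNat _ (hH n j.divNat j.divNat.2))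
    (fun n => Eventually.of_forall fun ω => by
      rw [← gainF_eq_sum_flat, hWK n ω]
      linarith [hK0 n ω])
    hconv
  simp only [← gainF_unflatten] at hgW
  have hgain := measurable_gainF hFle hS (predictableF_unflatten hg)
  refine ⟨fun ω => gainF S (unflatten g) T ω - max (gainF S (unflatten g) T ω - Wl ω) 0,
    ⟨unflatten g, predictableF_unflatten hg, _, (hgain.sub hWl).max measurable_const,
      fun ω => le_max_right _ _, fun ω => rfl⟩, ?_⟩
  rw [← eventually_qsFilter]
  filter_upwards [hgW] with ω hω
  rw [max_eq_left (sub_nonneg.2 hω)]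
  ring
end
end

section
/- One-period First Fundamental Theorem (Theorem 3.1): In the one-period market, the following are equivalent: (i) NA(𝒫) holds; (ii) for every P ∈ 𝒫 there exists Q ∈ 𝒬 such that P ≪ Q. -/
open MeasureTheory Set Filter Topology
open scoped ENNReal NNReal

noncomputable section

/-- Proper separation of the origin from a convex spanning set in finite dimension. -/
theorem Convex.exists_nonneg_pos_of_span_eq_top {E : Type*} [NormedAddCommGroup E]
    [NormedSpace ℝ E] [FiniteDimensional ℝ E] {s : Set E} (hs : Convex ℝ s) (hne : s.Nonempty)
    (h0 : (0 : E) ∉ s) (hspan : Submodule.span ℝ s = ⊤) :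
    ∃ f : E →L[ℝ] ℝ, (∀ x ∈ s, 0 ≤ f x) ∧ ∃ x ∈ s, 0 < f x := by
  by_cases hmem : (0 : E) ∈ affineSpan ℝ s
  · have htop : affineSpan ℝ s = ⊤ := by
      rw [← affineSpan_insert_eq_affineSpan ℝ hmem]
      apply SetLike.coe_injective
      rw [affineSpan_insert_zero, hspan]
      simp
    obtain ⟨f, hf0, hf⟩ := geometric_hahn_banach_of_nonempty_interior_point hs
      (x := 0) (fun h => h0 (interior_subset h))
      (hs.interior_nonempty_iff_affineSpan_eq_top.2 htop)
    refine ⟨-f, fun x hx => by simpa using hf x hx, ?_⟩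
    by_contra! hcon
    apply hf0
    have hker : Submodule.span ℝ s ≤ LinearMap.ker (f : E →ₗ[ℝ] ℝ) := by
      refine Submodule.span_le.2 fun x hx => ?_
      have h₁ := hf x hx
      have h₂ := hcon x hx
      simp at h₁ h₂ ⊢
      exact le_antisymm h₁ h₂
    ext x
    exact hker (hspan ▸ Submodule.mem_top)
  · obtain ⟨f, u, hfu, hu⟩ := geometric_hahn_banach_point_closed (affineSpan ℝ s).convex
      (AffineSubspace.closed_of_finiteDimensional _) hmem
    have hpos : ∀ x ∈ s, 0 < f x := fun x hx => by
      have := hu x (subset_affineSpan ℝ s hx)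
      simp at hfu
      linarith
    exact ⟨f, fun x hx => (hpos x hx).le, hne.imp fun x hx => ⟨hx, hpos x hx⟩⟩

/-- Proper separation of the origin from a convex set in finite dimension. -/
theorem Convex.exists_nonneg_pos_of_zero_notMem {E : Type*} [NormedAddCommGroup E]
    [NormedSpace ℝ E] [FiniteDimensional ℝ E] {s : Set E} (hs : Convex ℝ s) (hne : s.Nonempty)
    (h0 : (0 : E) ∉ s) :
    ∃ f : E →L[ℝ] ℝ, (∀ x ∈ s, 0 ≤ f x) ∧ ∃ x ∈ s, 0 < f x := by
  obtain ⟨x, hx⟩ := hne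
  obtain ⟨g, hg, y, hy, hgy⟩ := Convex.exists_nonneg_pos_of_span_eq_top
    (s := ((↑) : Submodule.span ℝ s → E) ⁻¹' s)
    (hs.linear_preimage (Submodule.span ℝ s).subtype)
    ⟨⟨x, Submodule.subset_span hx⟩, hx⟩ h0 Submodule.span_span_coe_preimage
  obtain ⟨f, hf⟩ := LinearMap.exists_extend (g : Submodule.span ℝ s →ₗ[ℝ] ℝ)
  have hfg : ∀ z : Submodule.span ℝ s, f z = g z := fun z => LinearMap.congr_fun hf z
  refine ⟨LinearMap.toContinuousLinearMap f, fun z hz => ?_, y, hy, ?_⟩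
  · simpa [hfg ⟨z, Submodule.subset_span hz⟩] using hg ⟨z, Submodule.subset_span hz⟩ hz
  · simpa [hfg y] using hgy

/-- `μ` reweighted by a strictly positive bounded density making `f` integrable. -/
def MeasureTheory.Measure.tame {Ω E : Type*} [MeasurableSpace Ω] [NormedAddCommGroup E]
    (μ : Measure Ω) (f : Ω → E) : Measure Ω :=
  μ.withDensity fun ω => (1 + ‖f ω‖ₑ)⁻¹

section Tame

variable {Ω E : Type*} [MeasurableSpace Ω] [NormedAddCommGroup E] {μ : Measure Ω} {f : Ω → E}

theorem MeasureTheory.Measure.tame_absolutelyContinuous : μ.tame f ≪ μ :=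
  withDensity_absolutelyContinuous _ _

instance MeasureTheory.Measure.isFiniteMeasure_tame [IsFiniteMeasure μ] :
    IsFiniteMeasure (μ.tame f) := by
  refine isFiniteMeasure_withDensity ((lintegral_mono (g := fun _ => 1) fun ω => ?_).trans_lt ?_).ne
  · simp
  · simp

variable [MeasurableSpace E] [BorelSpace E]

theorem MeasureTheory.Measure.absolutelyContinuous_tame (hf : Measurable f) : μ ≪ μ.tame f :=
  withDensity_absolutelyContinuous' (by fun_prop) (.of_forall fun ω => by simp)

theorem MeasureTheory.Measure.integrable_tame [SecondCountableTopology E] [IsFiniteMeasure μ]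
    (hf : Measurable f) : Integrable f (μ.tame f) := by
  refine ⟨hf.aestronglyMeasurable, ?_⟩
  rw [hasFiniteIntegral_iff_enorm, Measure.tame,
    lintegral_withDensity_eq_lintegral_mul _ (by fun_prop) (by fun_prop)]
  refine (lintegral_mono (g := fun _ => 1) fun ω => ?_).trans_lt (by simp)
  simp only [Pi.mul_apply]
  rw [mul_comm, ← div_eq_mul_inv]
  exact ENNReal.div_le_of_le_mul (by simp)

end Tame

namespace BN

theorem quasiSure_iff {Ω : Type*} [mΩ : MeasurableSpace Ω] {PP : Set (Measure Ω)} {p : Ω → Prop}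
    (hp : MeasurableSet {ω | p ω}) :
    QuasiSure PP mΩ p ↔ ∀ P ∈ PP, ∀ᵐ ω ∂P, p ω := by
  constructor
  · rintro ⟨A, -, hA, hPA⟩ P hP
    exact measure_mono_null hA (hPA P hP)
  · exact fun h => ⟨_, hp.compl, subset_rfl, h⟩

theorem expec_eq_zero_iff {Ω : Type*} [MeasurableSpace Ω] {Q : Measure Ω} {f : Ω → ℝ}
    (hf : Measurable f) : expec Q f = 0 ↔ Integrable f Q ∧ ∫ ω, f ω ∂Q = 0 := by
  constructor
  · intro h
    have hfin : ∫⁻ ω, ENNReal.ofReal (f ω) ∂Q ≠ ∞ ∧ ∫⁻ ω, ENNReal.ofReal (-f ω) ∂Q ≠ ∞ := by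
      unfold expec at h
      generalize ∫⁻ ω, ENNReal.ofReal (f ω) ∂Q = a at h ⊢
      generalize ∫⁻ ω, ENNReal.ofReal (-f ω) ∂Q = b at h ⊢
      constructor
      · rintro rfl
        induction b <;> simp at h
      · rintro rfl
        simp at h
    have hint : Integrable f Q := by
      refine ⟨hf.aestronglyMeasurable, ?_⟩
      rw [hasFiniteIntegral_iff_norm]
      have : ∀ ω, ENNReal.ofReal ‖f ω‖ = ENNReal.ofReal (f ω) + ENNReal.ofReal (-f ω) := by
        intro ω
        rcases le_total 0 (f ω) with h | h
        · simp [abs_of_nonneg h, ENNReal.ofReal_of_nonpos (neg_nonpos.2 h)]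
        · simp [abs_of_nonpos h, ENNReal.ofReal_of_nonpos h]
      simp_rw [this]
      rw [lintegral_add_left (by fun_prop)]
      exact ENNReal.add_lt_top.2 ⟨hfin.1.lt_top, hfin.2.lt_top⟩
    refine ⟨hint, ?_⟩
    rw [integral_eq_lintegral_pos_part_sub_lintegral_neg_part hint]
    unfold expec at h
    rw [← EReal.coe_ennreal_toReal hfin.1, ← EReal.coe_ennreal_toReal hfin.2] at h
    exact_mod_cast h
  · rintro ⟨hint, h⟩
    rw [integral_eq_lintegral_pos_part_sub_lintegral_neg_part hint] at h
    have hneg : ∫⁻ ω, ENNReal.ofReal (-f ω) ∂Q ≠ ∞ := hint.neg.lintegral_lt_top.ne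
    unfold expec
    rw [← EReal.coe_ennreal_toReal hint.lintegral_lt_top.ne, ← EReal.coe_ennreal_toReal hneg]
    exact_mod_cast h

/-- The barycenters of `X` under the finite measures lying between `P` and `PP`
in the sense of absolute continuity. -/
def barycenters {Ω E : Type*} [MeasurableSpace Ω] [NormedAddCommGroup E] [NormedSpace ℝ E]
    (PP : Set (Measure Ω)) (P : Measure Ω) (X : Ω → E) : Set E :=
  {x | ∃ ρ : Measure Ω, IsFiniteMeasure ρ ∧ P ≪ ρ ∧ (∃ P' ∈ PP, ρ ≪ P') ∧
    Integrable X ρ ∧ ∫ ω, X ω ∂ρ = x}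

section Barycenters

variable {Ω E : Type*} [MeasurableSpace Ω] [NormedAddCommGroup E] [NormedSpace ℝ E]
  {PP : Set (Measure Ω)} {P : Measure Ω} {X : Ω → E}

theorem exists_dominating_pair
    (hconv : ∀ P ∈ PP, ∀ P' ∈ PP, ∀ a b : ℝ≥0∞, a + b = 1 → a • P + b • P' ∈ PP)
    {P₁ P₂ : Measure Ω} (h₁ : P₁ ∈ PP) (h₂ : P₂ ∈ PP) : ∃ P₃ ∈ PP, P₁ ≪ P₃ ∧ P₂ ≪ P₃ := by
  refine ⟨_, hconv P₁ h₁ P₂ h₂ 2⁻¹ 2⁻¹ ENNReal.inv_two_add_inv_two, ?_, ?_⟩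
  · exact (Measure.AbsolutelyContinuous.rfl.smul_right (by simp)).add_right _
  · rw [add_comm]
    exact (Measure.AbsolutelyContinuous.rfl.smul_right (by simp)).add_right _

theorem add_smul_mem_barycenters
    (hconv : ∀ P ∈ PP, ∀ P' ∈ PP, ∀ a b : ℝ≥0∞, a + b = 1 → a • P + b • P' ∈ PP)
    {x : E} (hx : x ∈ barycenters PP P X) {ρ P' : Measure Ω} [IsFiniteMeasure ρ] (hP' : P' ∈ PP)
    (hρ : ρ ≪ P') (hX : Integrable X ρ) {a b : ℝ} (ha : 0 < a) (hb : 0 ≤ b) :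
    a • x + b • ∫ ω, X ω ∂ρ ∈ barycenters PP P X := by
  obtain ⟨ρ₀, _, hPρ₀, ⟨P₀, hP₀, hρP₀⟩, hX₀, rfl⟩ := hx
  obtain ⟨P₃, hP₃, h₀, h₁⟩ := exists_dominating_pair hconv hP₀ hP'
  have ha' : ENNReal.ofReal a ≠ 0 := by simpa using ha
  have hI₀ : Integrable X (ENNReal.ofReal a • ρ₀) := hX₀.smul_measure ENNReal.ofReal_ne_top
  have hI : Integrable X (ENNReal.ofReal b • ρ) := hX.smul_measure ENNReal.ofReal_ne_top
  have _ : IsFiniteMeasure (ENNReal.ofReal a • ρ₀) := ρ₀.smul_finite ENNReal.ofReal_ne_top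
  have _ : IsFiniteMeasure (ENNReal.ofReal b • ρ) := ρ.smul_finite ENNReal.ofReal_ne_top
  refine ⟨ENNReal.ofReal a • ρ₀ + ENNReal.ofReal b • ρ, inferInstance,
    (hPρ₀.smul_right ha').add_right _, ⟨P₃, hP₃, ?_⟩, hI₀.add_measure hI, ?_⟩
  · exact Measure.AbsolutelyContinuous.add_left ((hρP₀.trans h₀).smul_left _)
      ((hρ.trans h₁).smul_left _)
  · rw [integral_add_measure hI₀ hI, integral_smul_measure, integral_smul_measure,
      ENNReal.toReal_ofReal ha.le, ENNReal.toReal_ofReal hb]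

theorem convex_barycenters
    (hconv : ∀ P ∈ PP, ∀ P' ∈ PP, ∀ a b : ℝ≥0∞, a + b = 1 → a • P + b • P' ∈ PP) :
    Convex ℝ (barycenters PP P X) := by
  rw [convex_iff_forall_pos]
  rintro x hx y ⟨ρ, _, -, ⟨P', hP', hρP'⟩, hX, rfl⟩ a b ha hb -
  exact add_smul_mem_barycenters hconv hx hP' hρP' hX ha hb.le

theorem barycenters_nonempty [MeasurableSpace E] [BorelSpace E] [SecondCountableTopology E]
    [IsFiniteMeasure P] (hP : P ∈ PP) (hX : Measurable X) : (barycenters PP P X).Nonempty :=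
  ⟨_, P.tame X, inferInstance, Measure.absolutelyContinuous_tame hX,
    ⟨P, hP, Measure.tame_absolutelyContinuous⟩, Measure.integrable_tame hX, rfl⟩

/-- A functional that is nonnegative on the barycenters is nonnegative quasi surely. -/
theorem ae_nonneg_of_nonneg_barycenters [MeasurableSpace E] [BorelSpace E]
    [SecondCountableTopology E] [CompleteSpace E] [IsFiniteMeasure P]
    (hconv : ∀ P ∈ PP, ∀ P' ∈ PP, ∀ a b : ℝ≥0∞, a + b = 1 → a • P + b • P' ∈ PP)
    (hP : P ∈ PP) (hX : Measurable X) (f : E →L[ℝ] ℝ) (hf : ∀ x ∈ barycenters PP P X, 0 ≤ f x)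
    {P' : Measure Ω} [IsFiniteMeasure P'] (hP' : P' ∈ PP) : ∀ᵐ ω ∂P', 0 ≤ f (X ω) := by
  obtain ⟨x, hx⟩ := barycenters_nonempty hP hX
  set A : Set Ω := {ω | f (X ω) < 0} with hA
  have hAm : MeasurableSet A := measurableSet_lt (by fun_prop) measurable_const
  have hI : Integrable X ((P'.tame X).restrict A) := (Measure.integrable_tame hX).restrict
  have hfI : Integrable (fun ω => f (X ω)) ((P'.tame X).restrict A) := f.integrable_comp hI
  have hneg : ∀ᵐ ω ∂((P'.tame X).restrict A), f (X ω) < 0 := ae_restrict_mem hAm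
  have hint : 0 ≤ ∫ ω, f (X ω) ∂((P'.tame X).restrict A) := by
    by_contra! hlt
    set c := ∫ ω, f (X ω) ∂((P'.tame X).restrict A)
    have hb : 0 ≤ (f x + 1) / (-c) := div_nonneg (by linarith [hf x hx]) (by linarith)
    have key := hf _ (add_smul_mem_barycenters hconv hx hP'
      (Measure.absolutelyContinuous_of_le Measure.restrict_le_self |>.trans
        Measure.tame_absolutelyContinuous) hI one_pos hb)
    rw [map_add, map_smul, map_smul, ← f.integral_comp_comm hI] at key
    have hc : (f x + 1) / (-c) * c = -(f x + 1) := by field_simp [hlt.ne]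
    simp only [smul_eq_mul, one_mul] at key
    change 0 ≤ f x + (f x + 1) / (-c) * c at key
    linarith
  have hzero : ∀ᵐ ω ∂((P'.tame X).restrict A), -f (X ω) = 0 := by
    refine (integral_eq_zero_iff_of_nonneg_ae ?_ hfI.neg).1 ?_
    · filter_upwards [hneg] with ω hω
      simpa using hω.le
    · refine le_antisymm ?_ (integral_nonneg_of_ae ?_)
      · simpa [integral_neg] using hint
      · filter_upwards [hneg] with ω hω
        simpa using hω.le
  have hmeas : (P'.tame X).restrict A = 0 := by
    rw [← ae_eq_bot, ← Filter.eventually_false_iff_eq_bot]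
    filter_upwards [hneg, hzero] with ω h₁ h₂
    linarith
  rw [Measure.restrict_eq_zero] at hmeas
  have := Measure.absolutelyContinuous_tame hX hmeas
  rw [ae_iff]
  simpa [hA] using this

end Barycenters

end BN

open BN in
/-- **One-period First Fundamental Theorem** (Theorem 3.1). In the one-period market,
`NA(𝒫)` holds iff for every `P ∈ 𝒫` there exists `Q ∈ 𝒬` with `P ≪ Q`. -/
theorem one_period_first_fundamental_theorem
    (Ω : Type) [mΩ : MeasurableSpace Ω]
    (PP : Set (Measure Ω)) (hne : PP.Nonempty)
    (hprob : ∀ P ∈ PP, IsProbabilityMeasure P)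
    (hconv : ∀ P ∈ PP, ∀ P' ∈ PP, ∀ a b : ℝ≥0∞, a + b = 1 → a • P + b • P' ∈ PP)
    (d : ℕ) (S₀ : Fin d → ℝ) (S₁ : Ω → Fin d → ℝ) (hS₁ : Measurable S₁) :
    NA1 PP (fun ω i => S₁ ω i - S₀ i) ↔
      ∀ P ∈ PP, ∃ Q ∈ Q1set PP (fun ω i => S₁ ω i - S₀ i), P ≪ Q := by
  set X : Ω → Fin d → ℝ := fun ω i => S₁ ω i - S₀ i
  have hX : Measurable X := hS₁.sub_const S₀
  have hXi : ∀ i, Measurable fun ω => X ω i := fun i => (measurable_pi_apply i).comp hX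
  have hgain : ∀ y : Fin d → ℝ, Measurable fun ω => ∑ i, y i * X ω i := fun y => by fun_prop
  have hnonneg : ∀ y : Fin d → ℝ, MeasurableSet {ω | 0 ≤ ∑ i, y i * X ω i} := fun y =>
    measurableSet_le measurable_const (hgain y)
  have hzero : ∀ y : Fin d → ℝ, MeasurableSet {ω | ∑ i, y i * X ω i = 0} := fun y =>
    measurableSet_eq_fun (hgain y) measurable_const
  constructor
  · intro hNA P hP
    have := hprob P hP
    have h0 : (0 : Fin d → ℝ) ∈ barycenters PP P X := by
      by_contra h0
      obtain ⟨f, hf, x, ⟨ρ, _, -, ⟨P', hP', hρP'⟩, hI, rfl⟩, hpos⟩ :=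
        (convex_barycenters hconv).exists_nonneg_pos_of_zero_notMem
          (barycenters_nonempty hP hX) h0
      have hfX : ∀ ω, f (X ω) = ∑ i, f (Pi.single i 1) * X ω i := fun ω => by
        conv_lhs => rw [pi_eq_sum_univ' (X ω), map_sum]
        refine Finset.sum_congr rfl fun i _ => ?_
        rw [map_smul, smul_eq_mul, mul_comm]
      have hq := (quasiSure_iff (hzero _)).1 (hNA (fun i => f (Pi.single i 1))
        ((quasiSure_iff (hnonneg _)).2 fun P'' hP'' => by
          have := hprob P'' hP''
          simpa only [hfX] using ae_nonneg_of_nonneg_barycenters hconv hP hX f hf hP''))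
        P' hP'
      rw [← f.integral_comp_comm hI, integral_eq_zero_of_ae] at hpos
      · exact hpos.false
      · filter_upwards [hρP'.ae_le hq] with ω hω
        simpa only [hfX, Pi.zero_apply] using hω
    obtain ⟨ρ, _, hPρ, ⟨P', hP', hρP'⟩, hI, hρ⟩ := h0
    have hρ0 : NeZero ρ := ⟨fun h => by
      subst h
      exact IsProbabilityMeasure.ne_zero P (Measure.absolutelyContinuous_zero_iff.1 hPρ)⟩
    have hc : (ρ univ)⁻¹ ≠ ∞ := by simp [hρ0.out]
    refine ⟨(ρ univ)⁻¹ • ρ, ⟨inferInstance, ⟨P', hP', hρP'.smul_left _⟩, fun i => ?_⟩,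
      hPρ.smul_right (by simp)⟩
    let proj : (Fin d → ℝ) →L[ℝ] ℝ := .proj i
    have hIi : Integrable (fun ω => X ω i) ρ := proj.integrable_comp hI
    refine (expec_eq_zero_iff (hXi i)).2 ⟨hIi.smul_measure hc, ?_⟩
    have : ∫ ω, X ω i ∂ρ = 0 := (proj.integral_comp_comm hI).trans (by rw [hρ, map_zero])
    rw [integral_smul_measure, this, smul_zero]
  · intro hQ y hy
    rw [quasiSure_iff (hnonneg y)] at hy
    rw [quasiSure_iff (hzero y)]
    intro P hP
    obtain ⟨Q, ⟨_, ⟨P', hP', hQP'⟩, hmart⟩, hPQ⟩ := hQ P hP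
    have hmart' := fun i => (expec_eq_zero_iff (hXi i)).1 (hmart i)
    have hI : ∀ i ∈ Finset.univ, Integrable (fun ω => y i * X ω i) Q := fun i _ =>
      (hmart' i).1.const_mul (y i)
    refine hPQ.ae_le ((integral_eq_zero_iff_of_nonneg_ae (hQP'.ae_le (hy P' hP'))
      (integrable_finsetSum _ hI)).1 ?_)
    rw [integral_finsetSum _ hI]
    exact Finset.sum_eq_zero fun i _ => by rw [integral_const_mul, (hmart' i).2, mul_zero]
end
end

section
/- Approximate martingale measures (Lemma 3.6): Assume NA(𝒫) holds in the one-period market and let f be a random variable whose superhedging price π(f) := inf{x ∈ ℝ : ∃H ∈ ℝ^d with x + H·ΔS ≥ f 𝒫-q.s.} equals 0. Then there exist probability measures R_n ⋘ 𝒫 (n ≥ 1) with E_{R_n}[|ΔS| + |f|] < ∞ such that E_{R_n}[ΔS] → 0 in ℝ^d and E_{R_n}[f] → 0. -/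
open MeasureTheory Set Filter Topology
open scoped ENNReal NNReal

noncomputable section

namespace BN

section QuasiSure

variable {α : Type*} [MeasurableSpace α] {PP : Set (Measure α)} {p : α → Prop}

theorem QuasiSure.ae (h : QuasiSure PP ‹MeasurableSpace α› p) {P : Measure α} (hP : P ∈ PP) :
    ∀ᵐ ω ∂P, p ω := by
  obtain ⟨A, -, hsub, hA⟩ := h
  exact measure_mono_null hsub (hA P hP)

theorem quasiSure_of_ae (hp : MeasurableSet {ω | p ω}) (h : ∀ P ∈ PP, ∀ᵐ ω ∂P, p ω) :
    QuasiSure PP ‹MeasurableSpace α› p :=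
  ⟨{ω | ¬ p ω}, hp.compl, Subset.rfl, fun P hP => h P hP⟩

end QuasiSure

section Barycenters

variable {Ω E : Type*} [MeasurableSpace Ω] [NormedAddCommGroup E] [NormedSpace ℝ E]

/-- The integrals of `g` against the probabilities dominated by an element of `PP` that
integrate `g`. -/
def dominatedMeans (PP : Set (Measure Ω)) (g : Ω → E) : Set E :=
  {x | ∃ Q : Measure Ω, IsProbabilityMeasure Q ∧ (∃ P ∈ PP, Q ≪ P) ∧ Integrable g Q ∧
    ∫ ω, g ω ∂Q = x}

theorem convex_dominatedMeans {PP : Set (Measure Ω)}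
    (hconv : ∀ P ∈ PP, ∀ P' ∈ PP, ∀ a b : ℝ≥0∞, a + b = 1 → a • P + b • P' ∈ PP)
    (g : Ω → E) : Convex ℝ (dominatedMeans PP g) := by
  rintro _ ⟨R, hR, ⟨P, hP, hRP⟩, hgR, rfl⟩ _ ⟨R', hR', ⟨P', hP', hRP'⟩, hgR', rfl⟩ a b ha hb hab
  have hsum : ENNReal.ofReal a + ENNReal.ofReal b = 1 := by
    rw [← ENNReal.ofReal_add ha hb, hab, ENNReal.ofReal_one]
  have hgaR := hgR.smul_measure (ENNReal.ofReal_ne_top (r := a))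
  have hgbR' := hgR'.smul_measure (ENNReal.ofReal_ne_top (r := b))
  refine ⟨ENNReal.ofReal a • R + ENNReal.ofReal b • R', ⟨by simp [hsum]⟩,
    ⟨_, hconv P hP P' hP' 2⁻¹ 2⁻¹ ENNReal.inv_two_add_inv_two, ?_⟩,
    hgaR.add_measure hgbR', ?_⟩
  · refine Measure.AbsolutelyContinuous.mk fun s _ hs => ?_
    simp only [Measure.coe_add, Measure.coe_smul, Pi.add_apply, Pi.smul_apply, smul_eq_mul,
      add_eq_zero, mul_eq_zero, ENNReal.inv_eq_zero, ENNReal.ofNat_ne_top, false_or] at hs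
    simp [hRP hs.1, hRP' hs.2]
  · rw [integral_add_measure hgaR hgbR', integral_smul_measure, integral_smul_measure,
      ENNReal.toReal_ofReal ha, ENNReal.toReal_ofReal hb]

variable [FiniteDimensional ℝ E] [MeasurableSpace E] [BorelSpace E]

/-- A lower bound for a linear functional on all dominated means holds almost surely. -/
theorem ae_le_of_forall_dominatedMeans {PP : Set (Measure Ω)}
    (hprob : ∀ P ∈ PP, IsProbabilityMeasure P) {g : Ω → E} (hg : Measurable g)
    (L : E →L[ℝ] ℝ) {c : ℝ} (hL : ∀ x ∈ dominatedMeans PP g, c < L x)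
    {P : Measure Ω} (hP : P ∈ PP) : ∀ᵐ ω ∂P, c ≤ L (g ω) := by
  have := hprob P hP
  have hLg : Measurable fun ω => L (g ω) := L.continuous.measurable.comp hg
  have hnull (n : ℕ) : P {ω | L (g ω) < c ∧ ‖g ω‖ ≤ n} = 0 := by
    by_contra hpos
    set B := {ω | L (g ω) < c ∧ ‖g ω‖ ≤ n}
    have hB : MeasurableSet B :=
      (measurableSet_lt hLg measurable_const).inter (measurableSet_le hg.norm measurable_const)
    have hcond : IsProbabilityMeasure (ProbabilityTheory.cond P B) :=
      ProbabilityTheory.cond_isProbabilityMeasure hpos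
    have hmem : ∀ᵐ ω ∂(ProbabilityTheory.cond P B), ω ∈ B := ProbabilityTheory.ae_cond_mem hB
    have hint : Integrable g (ProbabilityTheory.cond P B) :=
      .of_bound hg.stronglyMeasurable.aestronglyMeasurable n (hmem.mono fun ω hω => hω.2)
    have hlt := hL _ ⟨_, hcond, ⟨P, hP, ProbabilityTheory.cond_absolutelyContinuous⟩, hint, rfl⟩
    rw [← L.integral_comp_comm hint] at hlt
    have hle : ∫ ω, L (g ω) ∂(ProbabilityTheory.cond P B)
        ≤ ∫ _, c ∂(ProbabilityTheory.cond P B) :=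
      integral_mono_ae (L.integrable_comp hint) (integrable_const c)
        (hmem.mono fun ω hω => hω.1.le)
    simp only [integral_const, probReal_univ, one_smul] at hle
    exact absurd hle hlt.not_ge
  refine measure_mono_null (fun ω hω => ?_) (measure_iUnion_null hnull)
  obtain ⟨n, hn⟩ := exists_nat_ge ‖g ω‖
  exact mem_iUnion.2 ⟨n, not_le.1 hω, hn⟩

/-- If no linear functional of `g` is quasi-surely bounded below by a positive constant, then
the origin is a limit of dominated means of `g`. -/
theorem zero_mem_closure_dominatedMeans {PP : Set (Measure Ω)}
    (hprob : ∀ P ∈ PP, IsProbabilityMeasure P)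
    (hconv : ∀ P ∈ PP, ∀ P' ∈ PP, ∀ a b : ℝ≥0∞, a + b = 1 → a • P + b • P' ∈ PP)
    {g : Ω → E} (hg : Measurable g)
    (h : ∀ (L : E →L[ℝ] ℝ) (c : ℝ), 0 < c → ¬ ∀ P ∈ PP, ∀ᵐ ω ∂P, c ≤ L (g ω)) :
    (0 : E) ∈ closure (dominatedMeans PP g) := by
  by_contra h0
  obtain ⟨L, c, hc, hL⟩ := geometric_hahn_banach_point_closed
    (convex_dominatedMeans hconv g).closure isClosed_closure h0
  rw [map_zero] at hc
  exact h L c hc fun P hP =>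
    ae_le_of_forall_dominatedMeans hprob hg L (fun x hx => hL x (subset_closure hx)) hP

end Barycenters

section OnePeriod

variable {Ω : Type*} [MeasurableSpace Ω] {d : ℕ} {PP : Set (Measure Ω)} {ΔS : Ω → Fin d → ℝ}

theorem measurable_sum_mul (hS : Measurable ΔS) (y : Fin d → ℝ) :
    Measurable fun ω => ∑ i, y i * ΔS ω i :=
  Finset.measurable_sum _ fun i _ => ((measurable_pi_iff.1 hS i).const_mul (y i))

/-- Under no-arbitrage, no strategy has a gain bounded below by a positive constant. -/
theorem NA1.not_forall_ae_le (hNA : NA1 PP ΔS) (hne : PP.Nonempty)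
    (hprob : ∀ P ∈ PP, IsProbabilityMeasure P) (hS : Measurable ΔS) (y : Fin d → ℝ) {c : ℝ}
    (hc : 0 < c) : ¬ ∀ P ∈ PP, ∀ᵐ ω ∂P, c ≤ ∑ i, y i * ΔS ω i := by
  intro h
  obtain ⟨P, hP⟩ := hne
  have := hprob P hP
  have hzero := (hNA y (quasiSure_of_ae
    (measurableSet_le measurable_const (measurable_sum_mul hS y))
    fun P hP => (h P hP).mono fun ω hω => hc.le.trans hω)).ae hP
  obtain ⟨ω, hω, hω'⟩ := (hzero.and (h P hP)).exists
  linarith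

/-- Under no-arbitrage, a claim with superhedging price zero cannot be combined with a trading
strategy so as to yield a payoff bounded below by a positive constant. -/
theorem not_forall_ae_le_of_superPrice1_eq_zero (hNA : NA1 PP ΔS) (hne : PP.Nonempty)
    (hprob : ∀ P ∈ PP, IsProbabilityMeasure P) (hS : Measurable ΔS) {f : Ω → ℝ}
    (hf : Measurable f) (hπ : superPrice1 PP ΔS f = 0) (y : Fin d → ℝ) (z : ℝ) {c : ℝ}
    (hc : 0 < c) : ¬ ∀ P ∈ PP, ∀ᵐ ω ∂P, c ≤ (∑ i, y i * ΔS ω i) + z * f ω := by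
  intro h
  have hscale (k : ℝ) (ω : Ω) : ∑ i, k * y i * ΔS ω i = k * ∑ i, y i * ΔS ω i := by
    simp only [Finset.mul_sum, mul_assoc]
  rcases lt_trichotomy z 0 with hz | rfl | hz
  · have hqs : QuasiSure PP ‹MeasurableSpace Ω›
        (fun ω => f ω ≤ c / z + ∑ i, -z⁻¹ * y i * ΔS ω i) := by
      refine quasiSure_of_ae (measurableSet_le hf
        (measurable_const.add (measurable_sum_mul hS _))) fun P hP => (h P hP).mono fun ω hω => ?_
      rw [hscale, show c / z + -z⁻¹ * ∑ i, y i * ΔS ω i = (c - ∑ i, y i * ΔS ω i) / z by ring,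
        le_div_iff_of_neg hz]
      linarith
    have hle : superPrice1 PP ΔS f ≤ ((c / z : ℝ) : EReal) := sInf_le ⟨_, ⟨_, hqs⟩, rfl⟩
    rw [hπ] at hle
    exact (div_neg_of_pos_of_neg hc hz).not_ge (EReal.coe_nonneg.1 hle)
  · exact hNA.not_forall_ae_le hne hprob hS y hc (by simpa using h)
  · have hlt : superPrice1 PP ΔS f < ((c / z : ℝ) : EReal) := by
      rw [hπ]
      exact EReal.coe_pos.2 (div_pos hc hz)
    obtain ⟨_, ⟨x, ⟨H, hH⟩, rfl⟩, hx⟩ := sInf_lt_iff.1 hlt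
    have hx' : x < c / z := EReal.coe_lt_coe_iff.1 hx
    refine hNA.not_forall_ae_le hne hprob hS (fun i => H i + z⁻¹ * y i) (sub_pos.2 hx')
      fun P hP => ?_
    filter_upwards [hH.ae hP, h P hP] with ω hω hω'
    have hdiv : c / z ≤ z⁻¹ * (∑ i, y i * ΔS ω i) + f ω := by
      rw [div_le_iff₀ hz]
      field_simp
      linarith
    simp only [add_mul, Finset.sum_add_distrib, hscale]
    linarith

end OnePeriod

end BN

open BN in
/-- **Approximate martingale measures** (Lemma 3.6). Under `NA(𝒫)` in the one-period
market, if `π(f) = 0` then there are probabilities `Rₙ ⋘ 𝒫` integrating `|ΔS| + |f|`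
with `E_{Rₙ}[ΔS] → 0` and `E_{Rₙ}[f] → 0`. -/
theorem approximate_martingale_measures
    (Ω : Type) [mΩ : MeasurableSpace Ω]
    (PP : Set (Measure Ω)) (hne : PP.Nonempty)
    (hprob : ∀ P ∈ PP, IsProbabilityMeasure P)
    (hconv : ∀ P ∈ PP, ∀ P' ∈ PP, ∀ a b : ℝ≥0∞, a + b = 1 → a • P + b • P' ∈ PP)
    (d : ℕ) (S₀ : Fin d → ℝ) (S₁ : Ω → Fin d → ℝ) (hS₁ : Measurable S₁)
    (hNA : NA1 PP (fun ω i => S₁ ω i - S₀ i))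
    (f : Ω → ℝ) (hf : Measurable f)
    (hπ : superPrice1 PP (fun ω i => S₁ ω i - S₀ i) f = (0 : EReal)) :
    ∃ R : ℕ → Measure Ω,
      (∀ n : ℕ, IsProbabilityMeasure (R n) ∧ (∃ P ∈ PP, R n ≪ P) ∧
        Integrable (fun ω => (fun i => S₁ ω i - S₀ i)) (R n) ∧ Integrable f (R n)) ∧
      Filter.Tendsto (fun n => (fun i => ∫ ω, (S₁ ω i - S₀ i) ∂(R n)))
        Filter.atTop (nhds (0 : Fin d → ℝ)) ∧
      Filter.Tendsto (fun n => ∫ ω, f ω ∂(R n)) Filter.atTop (nhds (0 : ℝ)) := by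
  set ΔS : Ω → Fin d → ℝ := fun ω i => S₁ ω i - S₀ i
  have hS : Measurable ΔS := hS₁.sub_const S₀
  have h0 : (0 : (Fin d → ℝ) × ℝ) ∈ closure (dominatedMeans PP fun ω => (ΔS ω, f ω)) := by
    refine zero_mem_closure_dominatedMeans hprob hconv (hS.prodMk hf) fun L c hc h => ?_
    refine not_forall_ae_le_of_superPrice1_eq_zero hNA hne hprob hS hf hπ
      (fun i => L (Pi.single i 1, 0)) (L (0, 1)) hc fun P hP => (h P hP).mono fun ω hω => ?_
    have hL : L (ΔS ω, f ω) = (∑ i, L (Pi.single i 1, 0) * ΔS ω i) + L (0, 1) * f ω := by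
      have hdecomp : (ΔS ω, f ω)
          = (∑ i, ΔS ω i • ((Pi.single i 1, 0) : (Fin d → ℝ) × ℝ)) + f ω • (0, 1) := by
        refine Prod.ext ?_ ?_
        · simpa [Prod.fst_sum] using pi_eq_sum_univ' (ΔS ω)
        · simp [Prod.snd_sum]
      rw [hdecomp, map_add, map_sum]
      simp only [map_smul, smul_eq_mul, mul_comm]
    rwa [← hL]
  obtain ⟨x, hx, hlim⟩ := mem_closure_iff_seq_limit.1 h0
  choose R hR hdom hint hmean using hx
  have hintS (n : ℕ) : Integrable ΔS (R n) := (hint n).fst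
  have hintf (n : ℕ) : Integrable f (R n) := (hint n).snd
  have hx_eq (n : ℕ) : x n = (fun i => ∫ ω, (S₁ ω i - S₀ i) ∂(R n), ∫ ω, f ω ∂(R n)) := by
    rw [← hmean n, integral_pair (hintS n) (hintf n)]
    congr 1
    ext i
    exact eval_integral (fun j => (hintS n).eval j) i
  simp only [funext hx_eq] at hlim
  exact ⟨R, fun n => ⟨hR n, hdom n, hintS n, hintf n⟩, hlim.fst_nhds, hlim.snd_nhds⟩
end
end
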